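/- (Π¹₁-hardness of C_rec and C_rec^-.) There exists a primitive recursive function f : ℕ → ℕ such that for every a: a ∈ O if and only if f(a) ∈ C_rec; moreover for every a ∈ O, f(a) ∈ C_rec^-, End(f(a)) = {∀x(x=x)}, and |f(a)| > |a|. Consequently a ∈ O if and only if f(a) ∈ C_rec^-, so f is simultaneously a many-one reduction of Kleene's O to C_rec and to C_rec^-. -/

import Mathlib

namespace Shoen

/-- Kleene application: value of the `e`-th partial recursive function at `n`,
in the standard numbering via `Nat.Partrec.Code`. -/
def peval (e n : ℕ) : Part ℕ := (Denumerable.ofNat Nat.Partrec.Code e).eval n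

/-- `e` is an index of a (total) primitive recursive function. -/
def PrimIndex (e : ℕ) : Prop := ∃ f : ℕ → ℕ, Nat.Primrec f ∧ ∀ n, peval e n = Part.some (f n)

/-- Kleene's relation `<_O`. -/
inductive KLt : ℕ → ℕ → Prop
  | base : KLt 1 2
  | step {a b : ℕ} : KLt a b → KLt b (2 ^ b)
  | lim {e : ℕ} (h : ∀ n, (peval e n).Dom)
      (hm : ∀ n, KLt ((peval e n).get (h n)) ((peval e (n + 1)).get (h (n + 1))))
      (n : ℕ) : KLt ((peval e n).get (h n)) (3 * 5 ^ e)
  | trans {a b c : ℕ} : KLt a b → KLt b c → KLt a c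

/-- Kleene's `O`. -/
def KO (a : ℕ) : Prop := KLt a (2 ^ a)

/-- The auxiliary relation `<'_O`. -/
inductive KLt' : ℕ → ℕ → Prop
  | base : KLt' 1 2
  | step {a b : ℕ} : KLt' a b → KLt' b (2 ^ b)
  | lim {e n x : ℕ} : x ∈ peval e n → KLt' x (3 * 5 ^ e)
  | trans {a b c : ℕ} : KLt' a b → KLt' b c → KLt' a c

/-- The inductive characterization `O'` of Kleene's `O`. -/
inductive KO' : ℕ → Prop
  | one : KO' 1
  | step {a : ℕ} : KO' a → KO' (2 ^ a)
  | lim {e : ℕ} (h : ∀ n, (peval e n).Dom)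
      (hm : ∀ n, KLt' ((peval e n).get (h n)) ((peval e (n + 1)).get (h (n + 1)))) :
      KO' (3 * 5 ^ e)



/-! ### Syntax of first order arithmetic (negation normal form) -/

/-- Terms of the language `0,1,+,×,=`, with de Bruijn variables. -/
inductive Trm : Type
  | var : ℕ → Trm
  | zero : Trm
  | one : Trm
  | add : Trm → Trm → Trm
  | mul : Trm → Trm → Trm
deriving DecidableEq

/-- Formulas in negation normal form: literals (atomic and negated atomic
formulas) combined by `∧, ∨, ∀, ∃` (de Bruijn binders). -/
inductive Fml : Type
  | eq : Trm → Trm → Fml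
  | ne : Trm → Trm → Fml
  | and : Fml → Fml → Fml
  | or : Fml → Fml → Fml
  | all : Fml → Fml
  | ex : Fml → Fml
deriving DecidableEq

/-- All free variables of a term are `< k`. -/
def Trm.cu : Trm → ℕ → Bool
  | .var i, k => decide (i < k)
  | .zero, _ => true
  | .one, _ => true
  | .add s t, k => s.cu k && t.cu k
  | .mul s t, k => s.cu k && t.cu k

/-- All free variables of a formula are `< k`. -/
def Fml.cu : Fml → ℕ → Bool
  | .eq s t, k => s.cu k && t.cu k
  | .ne s t, k => s.cu k && t.cu k
  | .and A B, k => A.cu k && B.cu k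
  | .or A B, k => A.cu k && B.cu k
  | .all A, k => A.cu (k + 1)
  | .ex A, k => A.cu (k + 1)

/-- A sentence is a closed formula. -/
abbrev Sentence : Type := { A : Fml // A.cu 0 = true }

/-- Value of a term under an environment. -/
def Trm.val (ρ : ℕ → ℕ) : Trm → ℕ
  | .var i => ρ i
  | .zero => 0
  | .one => 1
  | .add s t => s.val ρ + t.val ρ
  | .mul s t => s.val ρ * t.val ρ

/-- Extend an environment by a value for variable `0`. -/
def consEnv (n : ℕ) (ρ : ℕ → ℕ) : ℕ → ℕ
  | 0 => n
  | k + 1 => ρ k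

/-- Satisfaction in the standard model `ℕ`. -/
def Fml.Sat (ρ : ℕ → ℕ) : Fml → Prop
  | .eq s t => s.val ρ = t.val ρ
  | .ne s t => s.val ρ ≠ t.val ρ
  | .and A B => A.Sat ρ ∧ B.Sat ρ
  | .or A B => A.Sat ρ ∨ B.Sat ρ
  | .all A => ∀ n : ℕ, A.Sat (consEnv n ρ)
  | .ex A => ∃ n : ℕ, A.Sat (consEnv n ρ)

/-- Truth of a sentence in the standard model. -/
def sentTrue (A : Sentence) : Prop := A.1.Sat (fun _ => 0)

/-- Substitution of a closed term `t` for variable `k` in a term. -/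
def Trm.sub (t : Trm) (k : ℕ) : Trm → Trm
  | .var i => if i = k then t else if k < i then .var (i - 1) else .var i
  | .zero => .zero
  | .one => .one
  | .add s u => .add (Trm.sub t k s) (Trm.sub t k u)
  | .mul s u => .mul (Trm.sub t k s) (Trm.sub t k u)

/-- Substitution of a closed term `t` for variable `k` in a formula. -/
def Fml.sub (t : Trm) : Fml → ℕ → Fml
  | .eq s u, k => .eq (Trm.sub t k s) (Trm.sub t k u)
  | .ne s u, k => .ne (Trm.sub t k s) (Trm.sub t k u)
  | .and A B, k => .and (A.sub t k) (B.sub t k)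
  | .or A B, k => .or (A.sub t k) (B.sub t k)
  | .all A, k => .all (A.sub t (k + 1))
  | .ex A, k => .ex (A.sub t (k + 1))

/-- The numeral `n̄`. -/
def numeral : ℕ → Trm
  | 0 => .zero
  | n + 1 => .add (numeral n) .one

theorem Trm.cu_mono : ∀ (t : Trm) {j k : ℕ}, j ≤ k → t.cu j = true → t.cu k = true := by
  intro t
  induction t with
  | var i =>
    intro j k h ht
    simp only [Trm.cu, decide_eq_true_eq] at *
    omega
  | zero => intros; rfl
  | one => intros; rfl
  | add s u ihs ihu =>
    intro j k h ht
    simp only [Trm.cu, Bool.and_eq_true] at *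
    exact ⟨ihs h ht.1, ihu h ht.2⟩
  | mul s u ihs ihu =>
    intro j k h ht
    simp only [Trm.cu, Bool.and_eq_true] at *
    exact ⟨ihs h ht.1, ihu h ht.2⟩

theorem Trm.cu_sub : ∀ (s : Trm) {k : ℕ} {t : Trm},
    t.cu 0 = true → s.cu (k + 1) = true → (Trm.sub t k s).cu k = true := by
  intro s
  induction s with
  | var i =>
    intro k t ht hs
    simp only [Trm.cu, decide_eq_true_eq] at hs
    simp only [Trm.sub]
    by_cases h : i = k
    · rw [if_pos h]
      exact Trm.cu_mono t (Nat.zero_le k) ht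
    · have h2 : ¬ k < i := by omega
      rw [if_neg h, if_neg h2]
      simp only [Trm.cu, decide_eq_true_eq]
      omega
  | zero => intros; rfl
  | one => intros; rfl
  | add s u ihs ihu =>
    intro k t ht hs
    simp only [Trm.cu, Bool.and_eq_true] at hs
    simp only [Trm.sub, Trm.cu, Bool.and_eq_true]
    exact ⟨ihs ht hs.1, ihu ht hs.2⟩
  | mul s u ihs ihu =>
    intro k t ht hs
    simp only [Trm.cu, Bool.and_eq_true] at hs
    simp only [Trm.sub, Trm.cu, Bool.and_eq_true]
    exact ⟨ihs ht hs.1, ihu ht hs.2⟩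

theorem Fml.cu_sub : ∀ (A : Fml) {k : ℕ} {t : Trm},
    t.cu 0 = true → A.cu (k + 1) = true → (A.sub t k).cu k = true := by
  intro A
  induction A with
  | eq s u =>
    intro k t ht hA
    simp only [Fml.cu, Bool.and_eq_true] at hA
    simp only [Fml.sub, Fml.cu, Bool.and_eq_true]
    exact ⟨Trm.cu_sub s ht hA.1, Trm.cu_sub u ht hA.2⟩
  | ne s u =>
    intro k t ht hA
    simp only [Fml.cu, Bool.and_eq_true] at hA
    simp only [Fml.sub, Fml.cu, Bool.and_eq_true]
    exact ⟨Trm.cu_sub s ht hA.1, Trm.cu_sub u ht hA.2⟩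
  | and A B ihA ihB =>
    intro k t ht h
    simp only [Fml.cu, Bool.and_eq_true] at h
    simp only [Fml.sub, Fml.cu, Bool.and_eq_true]
    exact ⟨ihA ht h.1, ihB ht h.2⟩
  | or A B ihA ihB =>
    intro k t ht h
    simp only [Fml.cu, Bool.and_eq_true] at h
    simp only [Fml.sub, Fml.cu, Bool.and_eq_true]
    exact ⟨ihA ht h.1, ihB ht h.2⟩
  | all A ihA =>
    intro k t ht h
    simp only [Fml.cu] at h
    simp only [Fml.sub, Fml.cu]
    exact ihA ht h
  | ex A ihA =>
    intro k t ht h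
    simp only [Fml.cu] at h
    simp only [Fml.sub, Fml.cu]
    exact ihA ht h

theorem numeral_cu : ∀ n : ℕ, (numeral n).cu 0 = true := by
  intro n
  induction n with
  | zero => rfl
  | succ n ih => simp [numeral, Trm.cu, ih]

/-- Negation (de Morgan dual) of a formula in negation normal form. -/
def Fml.neg : Fml → Fml
  | .eq s t => .ne s t
  | .ne s t => .eq s t
  | .and A B => .or A.neg B.neg
  | .or A B => .and A.neg B.neg
  | .all A => .ex A.neg
  | .ex A => .all A.neg

theorem Fml.cu_neg : ∀ (A : Fml) {k : ℕ}, A.cu k = true → A.neg.cu k = true := by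
  intro A
  induction A with
  | eq s u => intro k h; simpa [Fml.cu, Fml.neg] using h
  | ne s u => intro k h; simpa [Fml.cu, Fml.neg] using h
  | and A B ihA ihB =>
    intro k h
    simp only [Fml.cu, Bool.and_eq_true] at h
    simp only [Fml.neg, Fml.cu, Bool.and_eq_true]
    exact ⟨ihA h.1, ihB h.2⟩
  | or A B ihA ihB =>
    intro k h
    simp only [Fml.cu, Bool.and_eq_true] at h
    simp only [Fml.neg, Fml.cu, Bool.and_eq_true]
    exact ⟨ihA h.1, ihB h.2⟩
  | all A ihA =>
    intro k h
    simp only [Fml.cu] at h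
    simp only [Fml.neg, Fml.cu]
    exact ihA h
  | ex A ihA =>
    intro k h
    simp only [Fml.cu] at h
    simp only [Fml.neg, Fml.cu]
    exact ihA h

/-- Conjunction of sentences. -/
def sAnd (A B : Sentence) : Sentence :=
  ⟨.and A.1 B.1, by simp [Fml.cu, A.2, B.2]⟩

/-- Disjunction of sentences. -/
def sOr (A B : Sentence) : Sentence :=
  ⟨.or A.1 B.1, by simp [Fml.cu, A.2, B.2]⟩

/-- Negation of a sentence. -/
def sNeg (A : Sentence) : Sentence := ⟨A.1.neg, Fml.cu_neg A.1 A.2⟩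

/-- The sentence `∀x A(x)`, for `A` with (at most) one free variable. -/
def sAll (A : Fml) (h : A.cu 1 = true) : Sentence := ⟨.all A, by simpa [Fml.cu] using h⟩

/-- The sentence `∃x A(x)`, for `A` with (at most) one free variable. -/
def sEx (A : Fml) (h : A.cu 1 = true) : Sentence := ⟨.ex A, by simpa [Fml.cu] using h⟩

/-- The instance `A(n̄)` of a formula `A` with one free variable. -/
def sInst (A : Fml) (h : A.cu 1 = true) (n : ℕ) : Sentence :=
  ⟨A.sub (numeral n) 0, Fml.cu_sub A (numeral_cu n) h⟩

/-- Literals: atomic and negated atomic formulas. -/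
def Fml.isLiteral : Fml → Bool
  | .eq _ _ => true
  | .ne _ _ => true
  | _ => false

/-- Quantifier free formulas. -/
def Fml.qf : Fml → Bool
  | .eq _ _ => true
  | .ne _ _ => true
  | .and A B => A.qf && B.qf
  | .or A B => A.qf && B.qf
  | .all _ => false
  | .ex _ => false

/-- An axiom is a sequent containing a true closed literal. -/
def IsAxiom (Γ : Finset Sentence) : Prop :=
  ∃ A ∈ Γ, A.1.isLiteral = true ∧ sentTrue A

/-- A sequent is true if some member is true. -/
def SeqTrue (Γ : Finset Sentence) : Prop := ∃ A ∈ Γ, sentTrue A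


/-! ### A primitive recursive Gödel numbering of terms, sentences and sequents -/

/-- Gödel number of a term. -/
def Trm.enc : Trm → ℕ
  | .var i => 5 * i
  | .zero => 1
  | .one => 2
  | .add s t => 5 * Nat.pair s.enc t.enc + 3
  | .mul s t => 5 * Nat.pair s.enc t.enc + 4

/-- Fuelled decoding of terms. -/
def Trm.dec : ℕ → ℕ → Option Trm
  | 0, _ => none
  | fuel + 1, n =>
    if n % 5 = 0 then some (.var (n / 5))
    else if n % 5 = 1 then some .zero
    else if n % 5 = 2 then some .one
    else if n % 5 = 3 then
      match Trm.dec fuel (n / 5).unpair.1, Trm.dec fuel (n / 5).unpair.2 with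
      | some s, some t => some (.add s t)
      | _, _ => none
    else
      match Trm.dec fuel (n / 5).unpair.1, Trm.dec fuel (n / 5).unpair.2 with
      | some s, some t => some (.mul s t)
      | _, _ => none

theorem Trm.dec_enc : ∀ (t : Trm) (fuel : ℕ), t.enc < fuel → Trm.dec fuel t.enc = some t := by
  intro t
  induction t with
  | var i =>
    intro fuel h
    match fuel with
    | f + 1 =>
      have h0 : (5 * i) % 5 = 0 := by omega
      have h1 : (5 * i) / 5 = i := by omega
      simp [Trm.dec, Trm.enc, h0, h1]
  | zero =>
    intro fuel h
    match fuel with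
    | f + 1 => simp [Trm.dec, Trm.enc]
  | one =>
    intro fuel h
    match fuel with
    | f + 1 => simp [Trm.dec, Trm.enc]
  | add s u ihs ihu =>
    intro fuel h
    match fuel with
    | f + 1 =>
      simp only [Trm.enc] at h ⊢
      set p := Nat.pair s.enc u.enc with hp
      have h0 : (5 * p + 3) % 5 = 3 := by omega
      have h1 : (5 * p + 3) / 5 = p := by omega
      have hs : s.enc < f := by
        have := Nat.left_le_pair s.enc u.enc
        omega
      have hu : u.enc < f := by
        have := Nat.right_le_pair s.enc u.enc
        omega
      simp only [Trm.dec, h0, h1]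
      rw [hp, Nat.unpair_pair, ihs f hs, ihu f hu]
      simp
  | mul s u ihs ihu =>
    intro fuel h
    match fuel with
    | f + 1 =>
      simp only [Trm.enc] at h ⊢
      set p := Nat.pair s.enc u.enc with hp
      have h0 : (5 * p + 4) % 5 = 4 := by omega
      have h1 : (5 * p + 4) / 5 = p := by omega
      have hs : s.enc < f := by
        have := Nat.left_le_pair s.enc u.enc
        omega
      have hu : u.enc < f := by
        have := Nat.right_le_pair s.enc u.enc
        omega
      simp only [Trm.dec, h0, h1]
      rw [hp, Nat.unpair_pair, ihs f hs, ihu f hu]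
      simp

instance : Encodable Trm :=
  ⟨Trm.enc, fun n => Trm.dec (n + 1) n, fun t => Trm.dec_enc t _ (Nat.lt_succ_self _)⟩

/-- Gödel number of a formula. -/
def Fml.enc : Fml → ℕ
  | .eq s t => 6 * Nat.pair s.enc t.enc
  | .ne s t => 6 * Nat.pair s.enc t.enc + 1
  | .and A B => 6 * Nat.pair A.enc B.enc + 2
  | .or A B => 6 * Nat.pair A.enc B.enc + 3
  | .all A => 6 * A.enc + 4
  | .ex A => 6 * A.enc + 5

/-- Fuelled decoding of formulas. -/
def Fml.dec : ℕ → ℕ → Option Fml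
  | 0, _ => none
  | fuel + 1, n =>
    if n % 6 = 0 then
      match Encodable.decode (α := Trm) (n / 6).unpair.1,
            Encodable.decode (α := Trm) (n / 6).unpair.2 with
      | some s, some t => some (.eq s t)
      | _, _ => none
    else if n % 6 = 1 then
      match Encodable.decode (α := Trm) (n / 6).unpair.1,
            Encodable.decode (α := Trm) (n / 6).unpair.2 with
      | some s, some t => some (.ne s t)
      | _, _ => none
    else if n % 6 = 2 then
      match Fml.dec fuel (n / 6).unpair.1, Fml.dec fuel (n / 6).unpair.2 with
      | some A, some B => some (.and A B)
      | _, _ => none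
    else if n % 6 = 3 then
      match Fml.dec fuel (n / 6).unpair.1, Fml.dec fuel (n / 6).unpair.2 with
      | some A, some B => some (.or A B)
      | _, _ => none
    else if n % 6 = 4 then
      match Fml.dec fuel (n / 6) with
      | some A => some (.all A)
      | none => none
    else
      match Fml.dec fuel (n / 6) with
      | some A => some (.ex A)
      | none => none

theorem Fml.dec_enc : ∀ (A : Fml) (fuel : ℕ), A.enc < fuel → Fml.dec fuel A.enc = some A := by
  intro A
  induction A with
  | eq s u =>
    intro fuel h
    match fuel with
    | f + 1 =>
      simp only [Fml.enc] at h ⊢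
      set p := Nat.pair s.enc u.enc with hp
      have h0 : (6 * p) % 6 = 0 := by omega
      have h1 : (6 * p) / 6 = p := by omega
      have hds : Encodable.decode (α := Trm) s.enc = some s := Encodable.encodek s
      have hdu : Encodable.decode (α := Trm) u.enc = some u := Encodable.encodek u
      simp only [Fml.dec, h0, h1]
      rw [hp, Nat.unpair_pair, hds, hdu]
      simp
  | ne s u =>
    intro fuel h
    match fuel with
    | f + 1 =>
      simp only [Fml.enc] at h ⊢
      set p := Nat.pair s.enc u.enc with hp
      have h0 : (6 * p + 1) % 6 = 1 := by omega
      have h1 : (6 * p + 1) / 6 = p := by omega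
      have hds : Encodable.decode (α := Trm) s.enc = some s := Encodable.encodek s
      have hdu : Encodable.decode (α := Trm) u.enc = some u := Encodable.encodek u
      simp only [Fml.dec, h0, h1]
      rw [hp, Nat.unpair_pair, hds, hdu]
      simp
  | and A B ihA ihB =>
    intro fuel h
    match fuel with
    | f + 1 =>
      simp only [Fml.enc] at h ⊢
      set p := Nat.pair A.enc B.enc with hp
      have h0 : (6 * p + 2) % 6 = 2 := by omega
      have h1 : (6 * p + 2) / 6 = p := by omega
      have hA : A.enc < f := by
        have := Nat.left_le_pair A.enc B.enc
        omega
      have hB : B.enc < f := by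
        have := Nat.right_le_pair A.enc B.enc
        omega
      simp only [Fml.dec, h0, h1]
      rw [hp, Nat.unpair_pair, ihA f hA, ihB f hB]
      simp
  | or A B ihA ihB =>
    intro fuel h
    match fuel with
    | f + 1 =>
      simp only [Fml.enc] at h ⊢
      set p := Nat.pair A.enc B.enc with hp
      have h0 : (6 * p + 3) % 6 = 3 := by omega
      have h1 : (6 * p + 3) / 6 = p := by omega
      have hA : A.enc < f := by
        have := Nat.left_le_pair A.enc B.enc
        omega
      have hB : B.enc < f := by
        have := Nat.right_le_pair A.enc B.enc
        omega
      simp only [Fml.dec, h0, h1]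
      rw [hp, Nat.unpair_pair, ihA f hA, ihB f hB]
      simp
  | all A ihA =>
    intro fuel h
    match fuel with
    | f + 1 =>
      simp only [Fml.enc] at h ⊢
      have h0 : (6 * A.enc + 4) % 6 = 4 := by omega
      have h1 : (6 * A.enc + 4) / 6 = A.enc := by omega
      have hA : A.enc < f := by omega
      simp [Fml.dec, h0, h1, ihA f hA]
  | ex A ihA =>
    intro fuel h
    match fuel with
    | f + 1 =>
      simp only [Fml.enc] at h ⊢
      have h0 : (6 * A.enc + 5) % 6 = 5 := by omega
      have h1 : (6 * A.enc + 5) / 6 = A.enc := by omega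
      have hA : A.enc < f := by omega
      simp [Fml.dec, h0, h1, ihA f hA]

instance : Encodable Fml :=
  ⟨Fml.enc, fun n => Fml.dec (n + 1) n, fun A => Fml.dec_enc A _ (Nat.lt_succ_self _)⟩

/-- Gödel number of a sentence. -/
def encF (A : Sentence) : ℕ := Encodable.encode A

/-- Gödel number of a sequent (finite set of sentences). -/
def encS (Γ : Finset Sentence) : ℕ := Encodable.encode Γ

/-- Decode a Gödel number into a sentence (with a default value). -/
def decF (n : ℕ) : Sentence := (Encodable.decode (α := Sentence) n).getD ⟨.eq .zero .zero, rfl⟩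

/-- Decode a Gödel number into a sequent (with a default value). -/
def decS (n : ℕ) : Finset Sentence := (Encodable.decode (α := Finset Sentence) n).getD ∅

/-! ### Tupling of natural numbers, with projections -/

/-- Code of a finite sequence (tuple) of natural numbers; codes are nonzero. -/
def tup (l : List ℕ) : ℕ := Encodable.encode l + 1

/-- The finite sequence coded by a natural number. -/
def untup (a : ℕ) : List ℕ := Denumerable.ofNat (List ℕ) (a - 1)

/-- The `i`-th projection `(a)_i`. -/
def proj (a i : ℕ) : ℕ := (untup a).getD i 0

/-- `a` codes a finite sequence (every nonzero number does, bijectively). -/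
def InSeq (a : ℕ) : Prop := a ≠ 0

/-- The code of the empty sequence `⟨⟩` (the root). -/
def rootSeq : ℕ := tup []

/-- The code of `σ⌢i`. -/
def snoc (σ i : ℕ) : ℕ := tup (untup σ ++ [i])

/-! ### Names for the inference rules -/

def axC : ℕ := 1
def andC : ℕ := 2
def orC : ℕ := 3
def omC : ℕ := 4
def exC : ℕ := 5
def cutC : ℕ := 6
def omrepC : ℕ := 7

/-- The end sequent of a (code of a) proof or proof node: `(a)_1` if the rule
`(a)_0` carries no main formula, and `(a)_1 ∪ {(a)_2}` otherwise. -/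
def EndS (a : ℕ) : Finset Sentence :=
  if proj a 0 = cutC ∨ proj a 0 = axC ∨ proj a 0 = omrepC then decS (proj a 1)
  else decS (proj a 1) ∪ {decF (proj a 2)}

/-! ### Local codes of ω-proofs -/

/-- Local codes of `ω`-proofs, in Tait style.  The three `Bool` parameters
respectively allow the cut rule, restrict the `ω`-rule to indices of primitive
recursive functions, and allow the vacuous `ω`-repetition rule. -/
inductive CGen (c p r : Bool) : ℕ → Prop
  | ax (Γ : Finset Sentence) (h : IsAxiom Γ) : CGen c p r (tup [axC, encS Γ])
  | and {a b : ℕ} (Γ : Finset Sentence) (A B : Sentence)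
      (ha : CGen c p r a) (hb : CGen c p r b)
      (ea : EndS a = Γ ∪ {A}) (eb : EndS b = Γ ∪ {B}) :
      CGen c p r (tup [andC, encS Γ, encF (sAnd A B), a, b])
  | or {a : ℕ} (Γ : Finset Sentence) (A B : Sentence) (ha : CGen c p r a)
      (ea : EndS a = Γ ∪ {A, B}) :
      CGen c p r (tup [orC, encS Γ, encF (sOr A B), a])
  | om {e : ℕ} (Γ : Finset Sentence) (A : Fml) (hA : A.cu 1 = true)
      (hp : p = true → PrimIndex e)
      (htot : ∀ n, (peval e n).Dom)
      (hmem : ∀ n, CGen c p r ((peval e n).get (htot n)))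
      (hend : ∀ n, EndS ((peval e n).get (htot n)) = Γ ∪ {sInst A hA n}) :
      CGen c p r (tup [omC, encS Γ, encF (sAll A hA), e])
  | ex {a : ℕ} (Γ : Finset Sentence) (A : Fml) (hA : A.cu 1 = true) (n : ℕ)
      (ha : CGen c p r a) (ea : EndS a = Γ ∪ {sInst A hA n}) :
      CGen c p r (tup [exC, encS Γ, encF (sEx A hA), a])
  | cut {a b : ℕ} (hc : c = true) (Γ : Finset Sentence) (C : Sentence)
      (ha : CGen c p r a) (hb : CGen c p r b)
      (ea : EndS a = Γ ∪ {C}) (eb : EndS b = Γ ∪ {sNeg C}) :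
      CGen c p r (tup [cutC, encS Γ, encF C, a, b])
  | omrep {e : ℕ} (hr : r = true) (Γ : Finset Sentence) (hp : PrimIndex e)
      (htot : ∀ n, (peval e n).Dom)
      (hmem : ∀ n, CGen c p r ((peval e n).get (htot n)))
      (hend : ∀ n, EndS ((peval e n).get (htot n)) = Γ) :
      CGen c p r (tup [omrepC, encS Γ, e])

/-- `C_rec`: recursive local codes of `ω`-proofs. -/
def Crec : ℕ → Prop := CGen true false false

/-- `C_rec^-`: the cut free fragment of `C_rec`. -/
def CrecM : ℕ → Prop := CGen false false false

/-- `C_prec`: primitive recursive local codes of `ω`-proofs. -/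
def Cprec : ℕ → Prop := CGen true true false

/-- `C_prec^-`: the cut free fragment of `C_prec`. -/
def CprecM : ℕ → Prop := CGen false true false

/-- `C_prec^{ω-rep}`: `C_prec` with the vacuous `ω`-repetition rule. -/
def CprecRep : ℕ → Prop := CGen true true true

/-! ### ω-proofs as well founded trees of sequents -/

/-- `σ` is a node of the tree `T_π = {σ ∈ Seq : π(σ) ∈ Seq}`. -/
def TreeOf (π : ℕ → ℕ) (σ : ℕ) : Prop := σ ≠ 0 ∧ π σ ≠ 0

/-- The tree `T_π` is well founded: it has no infinite branch. -/
def WFTree (π : ℕ → ℕ) : Prop :=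
  ¬ ∃ f : ℕ → ℕ, ∀ n : ℕ, TreeOf π (tup ((List.range n).map f))

/-- The inference at an inner node of an `ω`-proof is a correct instance of one
of the rules of Tait-style `ω`-arithmetic. -/
def CorrectInner (π : ℕ → ℕ) (σ : ℕ) : Prop :=
  (∃ (Γ : Finset Sentence) (A B : Sentence),
    π σ = tup [andC, encS Γ, encF (sAnd A B)] ∧
    TreeOf π (snoc σ 0) ∧ TreeOf π (snoc σ 1) ∧ ¬ TreeOf π (snoc σ 2) ∧
    EndS (π (snoc σ 0)) = Γ ∪ {A} ∧ EndS (π (snoc σ 1)) = Γ ∪ {B}) ∨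
  (∃ (Γ : Finset Sentence) (A B : Sentence),
    π σ = tup [orC, encS Γ, encF (sOr A B)] ∧
    TreeOf π (snoc σ 0) ∧ ¬ TreeOf π (snoc σ 1) ∧
    EndS (π (snoc σ 0)) = Γ ∪ {A, B}) ∨
  (∃ (Γ : Finset Sentence) (A : Fml) (hA : A.cu 1 = true),
    π σ = tup [omC, encS Γ, encF (sAll A hA)] ∧
    (∀ n : ℕ, TreeOf π (snoc σ n)) ∧
    (∀ n : ℕ, EndS (π (snoc σ n)) = Γ ∪ {sInst A hA n})) ∨
  (∃ (Γ : Finset Sentence) (A : Fml) (hA : A.cu 1 = true) (n : ℕ),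
    π σ = tup [exC, encS Γ, encF (sEx A hA)] ∧
    TreeOf π (snoc σ 0) ∧ ¬ TreeOf π (snoc σ 1) ∧
    EndS (π (snoc σ 0)) = Γ ∪ {sInst A hA n}) ∨
  (∃ (Γ : Finset Sentence) (C : Sentence),
    π σ = tup [cutC, encS Γ, encF C] ∧
    TreeOf π (snoc σ 0) ∧ TreeOf π (snoc σ 1) ∧ ¬ TreeOf π (snoc σ 2) ∧
    EndS (π (snoc σ 0)) = Γ ∪ {C} ∧ EndS (π (snoc σ 1)) = Γ ∪ {sNeg C})

/-- Local correctness of a function `π : ℕ → ℕ` viewed as a tree of sequents: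
all conditions in the definition of `ω`-proof except well-foundedness. -/
structure LocallyCorrect (π : ℕ → ℕ) : Prop where
  /-- values outside `Seq` are `0` -/
  nonseq : ∀ σ, ¬ InSeq (π σ) → π σ = 0
  /-- `T_π` is closed under initial segments -/
  downward : ∀ σ τ, TreeOf π σ → τ ≠ 0 → untup τ <+: untup σ → TreeOf π τ
  /-- children come first -/
  mono : ∀ σ i j, i < j → TreeOf π (snoc σ j) → TreeOf π (snoc σ i)
  /-- top nodes are axioms -/
  top : ∀ σ, TreeOf π σ → ¬ TreeOf π (snoc σ 0) →
    ∃ Γ : Finset Sentence, IsAxiom Γ ∧ π σ = tup [axC, encS Γ]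
  /-- inner nodes are correct inferences -/
  inner : ∀ σ, TreeOf π σ → TreeOf π (snoc σ 0) → CorrectInner π σ

/-- `π : ℕ → ℕ` is an `ω`-proof. -/
structure IsOmegaProof (π : ℕ → ℕ) extends LocallyCorrect π : Prop where
  /-- the tree `T_π` is well founded -/
  wf : WFTree π

/-- An `ω`-proof is cut free if no node is labelled `cut`. -/
def CutFree (π : ℕ → ℕ) : Prop := ∀ σ, TreeOf π σ → proj (π σ) 0 ≠ cutC

/-! ### The ω-proof `π(a)` coded by a local code `a` -/

open Classical in
/-- The code of the subproof at child `n` of the proof coded by `a`. -/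
noncomputable def childCode (a n : ℕ) : ℕ :=
  if proj a 0 = omC then
    (if h : (peval (proj a 3) n).Dom then (peval (proj a 3) n).get h else 0)
  else if proj a 0 = andC ∨ proj a 0 = orC ∨ proj a 0 = exC ∨ proj a 0 = cutC then
    proj a (n + 3)
  else 0

/-- Walk down a local code along a path. -/
noncomputable def walkCode (a : ℕ) : List ℕ → ℕ
  | [] => a
  | i :: l => walkCode (childCode a i) l

/-- The node label `⟨R,Γ,A⟩` (or `⟨Ax,Γ⟩`) determined by a local code. -/
def nodeVal (b : ℕ) : ℕ :=
  if proj b 0 = axC then tup [axC, proj b 1]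
  else if proj b 0 = andC ∨ proj b 0 = orC ∨ proj b 0 = omC ∨ proj b 0 = exC ∨ proj b 0 = cutC then
    tup [proj b 0, proj b 1, proj b 2]
  else 0

/-- The `ω`-proof `π(a)` determined by a local code `a` (with value `0` at all
other arguments). -/
noncomputable def piOf (a : ℕ) (σ : ℕ) : ℕ :=
  if σ = 0 then 0 else nodeVal (walkCode a (untup σ))

/-! ### Indices (global codes) of recursive and primitive recursive ω-proofs -/

/-- `I_rec`: `a` is an index of a recursive `ω`-proof. -/
def Irec (a : ℕ) : Prop :=
  ∃ h : ∀ n, (peval a n).Dom, IsOmegaProof (fun n => (peval a n).get (h n))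

/-- `I_prec`: `a` is an index of a primitive recursive `ω`-proof. -/
def Iprec (a : ℕ) : Prop :=
  ∃ f : ℕ → ℕ, Nat.Primrec f ∧ (∀ n, peval a n = Part.some (f n)) ∧ IsOmegaProof f

/-- `I_prec^-`: `a` is an index of a primitive recursive cut free `ω`-proof. -/
def IprecM (a : ℕ) : Prop :=
  ∃ f : ℕ → ℕ, Nat.Primrec f ∧ (∀ n, peval a n = Part.some (f n)) ∧
    IsOmegaProof f ∧ CutFree f

/-! ### Ordinal lengths -/

open Classical in
/-- `x + 1` if `P` holds, and `0` otherwise. -/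
noncomputable def succIf (P : Prop) (x : Ordinal.{0}) : Ordinal.{0} :=
  if P then x + 1 else 0

/-- The ordinal rank of a node of the tree `T_π`:
`rank σ = sup {rank (σ⌢i) + 1 : σ⌢i ∈ T_π}`. -/
inductive NodeRank (π : ℕ → ℕ) : ℕ → Ordinal.{0} → Prop
  | mk (σ : ℕ) (o : ℕ → Ordinal.{0})
      (h : ∀ i, TreeOf π (snoc σ i) → NodeRank π (snoc σ i) (o i)) :
      NodeRank π σ (⨆ i, succIf (TreeOf π (snoc σ i)) (o i))

/-- The ordinal length of a local code:  `|⟨Ax,Γ⟩| = 0`,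
`|⟨R,Γ,A,a₁,…,a_k⟩| = sup{|a₁|,…,|a_k|} + 1`, and
`|⟨ω,Γ,∀xA(x),e⟩| = sup{|⟨e⟩(n)| + 1 : n ∈ ℕ}`. -/
inductive CLen : ℕ → Ordinal.{0} → Prop
  | ax (g : ℕ) : CLen (tup [axC, g]) 0
  | one (R g x a : ℕ) (o : Ordinal.{0}) (hR : R = orC ∨ R = exC) (h : CLen a o) :
      CLen (tup [R, g, x, a]) (o + 1)
  | two (R g x a b : ℕ) (oa ob : Ordinal.{0}) (hR : R = andC ∨ R = cutC)
      (ha : CLen a oa) (hb : CLen b ob) :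
      CLen (tup [R, g, x, a, b]) ((oa ⊔ ob) + 1)
  | om (g x e : ℕ) (h : ∀ n, (peval e n).Dom) (o : ℕ → Ordinal.{0})
      (ho : ∀ n, CLen ((peval e n).get (h n)) (o n)) :
      CLen (tup [omC, g, x, e]) (⨆ n, o n + 1)

/-- The ordinal `|a|` of a notation `a ∈ O`:  `|1| = 0`, `|2^a| = |a| + 1`,
`|3·5^e| = sup{|⟨e⟩(n)| : n ∈ ℕ}`. -/
inductive KOrd : ℕ → Ordinal.{0} → Prop
  | one : KOrd 1 0
  | step {a : ℕ} {o : Ordinal.{0}} : KOrd a o → KOrd (2 ^ a) (o + 1)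
  | lim {e : ℕ} (h : ∀ n, (peval e n).Dom) (o : ℕ → Ordinal.{0})
      (ho : ∀ n, KOrd ((peval e n).get (h n)) (o n)) :
      KOrd (3 * 5 ^ e) (⨆ n, o n)


open Classical in
/-- One step of the sequence `a(f)` determined by a local code. -/
noncomputable def branchStep (b k : ℕ) : Option ℕ :=
  if (∃ (Γ : Finset Sentence) (A B : Sentence) (b₀ b₁ : ℕ),
        b = tup [andC, encS Γ, encF (sAnd A B), b₀, b₁]) ∨
     (∃ (Γ : Finset Sentence) (C : Sentence) (b₀ b₁ : ℕ),
        b = tup [cutC, encS Γ, encF C, b₀, b₁]) then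
    some (proj b (3 + k % 2))
  else if ∃ (Γ : Finset Sentence) (A B : Sentence) (c : ℕ),
      b = tup [orC, encS Γ, encF (sOr A B), c] then
    some (proj b 3)
  else if ∃ (Γ : Finset Sentence) (A : Fml) (hA : A.cu 1 = true) (e : ℕ),
      b = tup [omC, encS Γ, encF (sAll A hA), e] then
    (if h : (peval (proj b 3) k).Dom then some ((peval (proj b 3) k).get h) else none)
  else none

/-- The sequence `a(f) = ⟨a₀,a₁,…⟩`:  `chain a f i = some aᵢ` if the `i`-th
element of the sequence is defined, and `none` otherwise. -/
noncomputable def chain (a : ℕ) (f : ℕ → ℕ) : ℕ → Option ℕ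
  | 0 => some a
  | i + 1 =>
    match chain a f i with
    | none => none
    | some b => branchStep b (f i)

/-! ### Gödel numbers of sequents -/

theorem encS_eq_encode_sorted_codes (Γ : Finset Sentence) :
    ∃ l : List ℕ, encS Γ = Encodable.encode l ∧ l.Pairwise (· < ·) ∧
      ∀ v, v ∈ l ↔ ∃ A ∈ Γ, encF A = v := by
  have key : ∃ m : List Sentence, encS Γ = Encodable.encode m ∧
      m.Pairwise (fun A B => encF A ≤ encF B) ∧ (m : Multiset Sentence) = Γ.1 :=
    have : IsTrans Sentence (fun A B => encF A ≤ encF B) := ⟨fun _ _ _ => le_trans⟩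
    have : Std.Antisymm (fun A B : Sentence => encF A ≤ encF B) :=
      ⟨fun _ _ h h' => Encodable.encode_injective (le_antisymm h h')⟩
    have : Std.Total (fun A B : Sentence => encF A ≤ encF B) := ⟨fun _ _ => le_total _ _⟩
    ⟨Γ.1.sort (fun A B => encF A ≤ encF B), rfl, Multiset.pairwise_sort _ _,
      Multiset.sort_eq _ _⟩
  obtain ⟨m, hm, hs, he⟩ := key
  have hnd : m.Nodup := by
    have := Γ.2
    rwa [← he] at this
  refine ⟨m.map encF, ?_, ?_, ?_⟩
  · rw [hm]
    clear hm hs he hnd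
    induction m with
    | nil => rfl
    | cons A m ih => simp only [List.map_cons, Encodable.encode_list_cons, ih]; rfl
  · rw [List.pairwise_map]
    refine (hs.and hnd).imp ?_
    rintro A B ⟨h1, h2⟩
    exact lt_of_le_of_ne h1 fun h => h2 (Encodable.encode_injective h)
  · intro v
    have : ∀ A, A ∈ m ↔ A ∈ Γ := fun A => by
      rw [← Finset.mem_val, ← he]; rfl
    simp [this]

open Nat.Partrec (Code)

/-! ### Contexts -/

/-- The sentence `∀x(x=x)`. -/
def reflAll : Sentence := sAll (.eq (.var 0) (.var 0)) (by decide)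

/-- The sentence `n̄=n̄`. -/
def reflInst (n : ℕ) : Sentence := sInst (.eq (.var 0) (.var 0)) (by decide) n

/-- Insertion of a number into a strictly increasing list. -/
def insertCode (v : ℕ) (l : List ℕ) : List ℕ :=
  l.filter (fun u => u < v) ++ v :: l.filter (fun u => v < u)

/-- On Gödel numbers of sequents, the operation `Γ ↦ Γ ∪ {n̄=n̄}`. -/
def addRefl (k n : ℕ) : ℕ :=
  Encodable.encode (insertCode (encF (reflInst n)) (Denumerable.ofNat (List ℕ) k))

theorem mem_insertCode {v u : ℕ} {l : List ℕ} : u ∈ insertCode v l ↔ u = v ∨ u ∈ l := by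
  simp only [insertCode, List.mem_append, List.mem_cons, List.mem_filter, decide_eq_true_eq]
  rcases lt_trichotomy u v with h | h | h
  · simp [h, h.ne, h.not_gt]
  · simp [h]
  · simp [h, h.ne', h.not_gt]

theorem pairwise_insertCode {v : ℕ} {l : List ℕ} (h : l.Pairwise (· < ·)) :
    (insertCode v l).Pairwise (· < ·) := by
  rw [insertCode, List.pairwise_append, List.pairwise_cons]
  refine ⟨h.filter _, ⟨fun u hu => ?_, h.filter _⟩, fun u hu w hw => ?_⟩
  · simpa using (List.mem_filter.1 hu).2
  · have huv : u < v := by simpa using (List.mem_filter.1 hu).2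
    rcases List.mem_cons.1 hw with rfl | hw
    · exact huv
    · exact huv.trans (by simpa using (List.mem_filter.1 hw).2)

theorem addRefl_encS (Γ : Finset Sentence) (n : ℕ) :
    addRefl (encS Γ) n = encS (Γ ∪ {reflInst n}) := by
  obtain ⟨l, hl, hs, hm⟩ := encS_eq_encode_sorted_codes Γ
  obtain ⟨l', hl', hs', hm'⟩ := encS_eq_encode_sorted_codes (Γ ∪ {reflInst n})
  rw [addRefl, hl, hl', Denumerable.ofNat_encode]
  congr 1
  have hmem : ∀ v, v ∈ insertCode (encF (reflInst n)) l ↔ v ∈ l' := fun v => by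
    rw [mem_insertCode, hm, hm']
    constructor
    · rintro (rfl | ⟨A, hA, rfl⟩)
      · exact ⟨_, by simp, rfl⟩
      · exact ⟨A, by simp [hA], rfl⟩
    · rintro ⟨A, hA, rfl⟩
      rcases Finset.mem_union.1 hA with hA | hA
      · exact Or.inr ⟨A, hA, rfl⟩
      · exact Or.inl (by rw [Finset.mem_singleton.1 hA])
  exact List.Subset.antisymm_of_sortedLT (fun v => (hmem v).1) (fun v => (hmem v).2)
    (pairwise_insertCode hs).sortedLT hs'.sortedLT

theorem primrec_enc_numeral : Primrec fun n => (numeral n).enc := by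
  have h : Primrec (Nat.rec 1 fun _ c => 5 * Nat.pair c 2 + 3 : ℕ → ℕ) :=
    Primrec.nat_rec₁ 1 (Primrec.nat_add.comp (Primrec.nat_mul.comp (Primrec.const 5)
      (Primrec₂.natPair.comp Primrec.snd (Primrec.const 2))) (Primrec.const 3))
  refine h.of_eq fun n => ?_
  induction n with
  | zero => rfl
  | succ n ih => simp only [numeral, Trm.enc, ← ih]

theorem primrec_encF_reflInst : Primrec fun n => encF (reflInst n) :=
  (Primrec.nat_mul.comp (Primrec.const 6)
    (Primrec₂.natPair.comp primrec_enc_numeral primrec_enc_numeral)).of_eq fun _ => rfl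

theorem primrec_insertCode : Primrec₂ insertCode := by
  have hlt : Primrec₂ fun (l : List ℕ) (v : ℕ) => l.filter (fun u => u < v) :=
    PrimrecRel.listFilter Primrec.nat_lt
  have hgt : Primrec₂ fun (l : List ℕ) (v : ℕ) => l.filter (fun u => v < u) :=
    PrimrecRel.listFilter (R := fun u v => v < u) (Primrec.nat_lt.comp Primrec.snd Primrec.fst)
  exact Primrec.list_append.comp (hlt.comp Primrec.snd Primrec.fst)
    (Primrec.list_cons.comp Primrec.fst (hgt.comp Primrec.snd Primrec.fst))

theorem primrec_addRefl : Primrec₂ addRefl :=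
  Primrec.encode.comp (primrec_insertCode.comp (primrec_encF_reflInst.comp Primrec.snd)
    ((Primrec.ofNat (List ℕ)).comp Primrec.fst))

theorem primrec_tup : Primrec tup := Primrec.succ.comp Primrec.encode

/-! ### Fundamental sequences and the descent search -/

/-- The `b` with `a = 2 ^ b`, if there is one. -/
def twoLog (a : ℕ) : ℕ := Nat.findGreatest (fun b => 2 ^ b = a) a

/-- The `e` with `a = 3 * 5 ^ e`, if there is one. -/
def fiveLog (a : ℕ) : ℕ := Nat.findGreatest (fun e => 3 * 5 ^ e = a) a

theorem twoLog_two_pow (b : ℕ) : twoLog (2 ^ b) = b :=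
  Nat.pow_right_injective le_rfl
    (Nat.findGreatest_spec (P := fun c => 2 ^ c = 2 ^ b) Nat.lt_two_pow_self.le rfl)

theorem fiveLog_three_mul (e : ℕ) : fiveLog (3 * 5 ^ e) = e := by
  have h : e ≤ 3 * 5 ^ e := by
    have := Nat.lt_pow_self (n := e) (a := 5) (by norm_num)
    omega
  have := Nat.findGreatest_spec (P := fun c => 3 * 5 ^ c = 3 * 5 ^ e) h rfl
  exact Nat.pow_right_injective (a := 5) (by norm_num) (Nat.eq_of_mul_eq_mul_left three_pos this)

theorem two_pow_ne_three_mul (b e : ℕ) : 2 ^ b ≠ 3 * 5 ^ e := fun h => by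
  have : 3 ∣ 2 ^ b := ⟨_, h⟩
  have := Nat.prime_three.dvd_of_dvd_pow this
  omega

/-- Immediate predecessors: `b` for `2 ^ b`, `⟨e⟩(n)` for `3 * 5 ^ e`, and `0` for all
other numbers. -/
def fundSeq (a n : ℕ) : Part ℕ :=
  if 2 ^ twoLog a = a then Part.some (twoLog a)
  else if 3 * 5 ^ fiveLog a = a then peval (fiveLog a) n
  else Part.some 0

theorem fundSeq_two_pow (b n : ℕ) : fundSeq (2 ^ b) n = Part.some b := by
  simp [fundSeq, twoLog_two_pow]

theorem fundSeq_three_mul (e n : ℕ) : fundSeq (3 * 5 ^ e) n = peval e n := by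
  simp [fundSeq, fiveLog_three_mul, two_pow_ne_three_mul]

/-- The result of `i` steps of descent from `a` guided by the list `l`. -/
def descend (a : ℕ) (l : List ℕ) (i : ℕ) : Part ℕ :=
  i.rec (Part.some a) fun j p => p.bind fun z => fundSeq z (l.getD j 0)

theorem descend_zero (a : ℕ) (l : List ℕ) : descend a l 0 = Part.some a := rfl

theorem descend_succ (a : ℕ) (l : List ℕ) (i : ℕ) :
    descend a l (i + 1) = (descend a l i).bind fun z => fundSeq z (l.getD i 0) := rfl

theorem descend_cons (a n : ℕ) (l : List ℕ) (i : ℕ) :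
    descend a (n :: l) (i + 1) = (fundSeq a n).bind fun z => descend z l i := by
  induction i with
  | zero => simp [descend_succ, descend_zero]
  | succ i ih =>
    rw [descend_succ, ih, Part.bind_assoc]
    rfl

/-- Search for a descent from `y` to `x` in at least one step. -/
def searchBelow (x y : ℕ) : Part ℕ :=
  Nat.rfind fun j => (descend y (Denumerable.ofNat (List ℕ) j)
    ((Denumerable.ofNat (List ℕ) j).length.pred + 1)).map fun z => decide (z = x)

theorem partrec_ite {α σ : Type*} [Primcodable α] [Primcodable σ] {p : α → Prop}
    [DecidablePred p] {f g : α →. σ} (hp : PrimrecPred p) (hf : Partrec f) (hg : Partrec g) :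
    Partrec fun a => if p a then f a else g a :=
  (Partrec.cond hp.decide.to_comp hf hg).of_eq fun a => by by_cases h : p a <;> simp [h]

theorem primrec_two_pow : Primrec fun a : ℕ => 2 ^ a :=
  (Primrec₂.unpaired'.1 Nat.Primrec.pow).comp (Primrec.const 2) Primrec.id

theorem primrec_three_mul : Primrec fun a : ℕ => 3 * 5 ^ a :=
  Primrec.nat_mul.comp (Primrec.const 3)
    ((Primrec₂.unpaired'.1 Nat.Primrec.pow).comp (Primrec.const 5) Primrec.id)

theorem primrec_twoLog : Primrec twoLog :=
  Primrec.nat_findGreatest Primrec.id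
    (Primrec.eq.comp (primrec_two_pow.comp Primrec.snd) Primrec.fst)

theorem primrec_fiveLog : Primrec fiveLog :=
  Primrec.nat_findGreatest Primrec.id
    (Primrec.eq.comp (primrec_three_mul.comp Primrec.snd) Primrec.fst)

theorem primrecPred_isLim : PrimrecPred fun a : ℕ => 3 * 5 ^ fiveLog a = a :=
  Primrec.eq.comp (primrec_three_mul.comp primrec_fiveLog) Primrec.id

theorem partrec_peval : Partrec₂ peval :=
  Code.eval_part.comp ((Computable.ofNat Code).comp Computable.fst) Computable.snd

theorem partrec_fundSeq : Partrec₂ fundSeq := by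
  refine partrec_ite (p := fun q : ℕ × ℕ => 2 ^ twoLog q.1 = q.1)
    ((Primrec.eq.comp (primrec_two_pow.comp primrec_twoLog) Primrec.id).comp Primrec.fst)
    (primrec_twoLog.comp Primrec.fst).to_comp
    (partrec_ite (p := fun q : ℕ × ℕ => 3 * 5 ^ fiveLog q.1 = q.1)
      (primrecPred_isLim.comp Primrec.fst) ?_ (Computable.const 0))
  exact partrec_peval.comp (primrec_fiveLog.comp Primrec.fst).to_comp Computable.snd

theorem partrec_descend : Partrec fun q : (ℕ × List ℕ) × ℕ => descend q.1.1 q.1.2 q.2 := by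
  have hstep : Partrec₂ fun (q : (ℕ × List ℕ) × ℕ) (r : ℕ × ℕ) =>
      fundSeq r.2 (q.1.2.getD r.1 0) :=
    partrec_fundSeq.comp (Computable.snd.comp Computable.snd)
      ((Primrec.list_getD 0).to_comp.comp
        (Computable.snd.comp (Computable.fst.comp Computable.fst))
        (Computable.fst.comp Computable.snd))
  exact Partrec.nat_rec Computable.snd (Computable.fst.comp Computable.fst).partrec hstep

theorem partrec_searchBelow : Partrec₂ searchBelow := by
  have hl : Computable fun q : (ℕ × ℕ) × ℕ => Denumerable.ofNat (List ℕ) q.2 :=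
    (Computable.ofNat (List ℕ)).comp Computable.snd
  have hd : Partrec fun q : (ℕ × ℕ) × ℕ => descend q.1.2 (Denumerable.ofNat (List ℕ) q.2)
      ((Denumerable.ofNat (List ℕ) q.2).length.pred + 1) :=
    partrec_descend.comp (((Computable.snd.comp Computable.fst).pair hl).pair
      (Computable.succ.comp (Computable.pred.comp (Computable.list_length.comp hl))))
  have he : Computable₂ fun (q : (ℕ × ℕ) × ℕ) (z : ℕ) => decide (z = q.1.1) :=
    (Primrec.eq.decide.comp Primrec.snd
      (Primrec.fst.comp (Primrec.fst.comp Primrec.fst))).to_comp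
  exact Partrec.rfind (p := fun (q : ℕ × ℕ) j => (descend q.2 (Denumerable.ofNat (List ℕ) j)
    ((Denumerable.ofNat (List ℕ) j).length.pred + 1)).map fun z => decide (z = q.1)) (hd.map he)

/-! ### The reduction -/

/-- The code of a proof of the sequent numbered `k` (containing `∀x(x=x)`), with last
inference an `ω`-rule whose premises are computed by `c` from `a` and `k`. -/
def reflProof (c : Code) (a k : ℕ) : ℕ :=
  tup [omC, k, encF reflAll, Encodable.encode (c.curry (Nat.pair a k))]

/-- The `n`-th premise of `reflProof c a k`. -/
def premise (c : Code) (a k n : ℕ) : Part ℕ :=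
  if a = 1 then Part.some (tup [axC, addRefl k n])
  else (fundSeq a n).bind fun x =>
    (if 3 * 5 ^ fiveLog a = a then (fundSeq a (n + 1)).bind (searchBelow x)
      else Part.some 0).map fun _ => reflProof c x (addRefl k n)

theorem primrec_reflProof : Primrec fun q : Code × ℕ × ℕ => reflProof q.1 q.2.1 q.2.2 :=
  primrec_tup.comp <| Primrec.list_cons.comp (Primrec.const omC) <|
    Primrec.list_cons.comp (Primrec.snd.comp Primrec.snd) <|
    Primrec.list_cons.comp (Primrec.const (encF reflAll)) <|
    Primrec.list_cons.comp (Primrec.encode.comp (Code.primrec₂_curry.comp Primrec.fst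
      (Primrec₂.natPair.comp (Primrec.fst.comp Primrec.snd) (Primrec.snd.comp Primrec.snd))))
      (Primrec.const [])

theorem partrec_premise :
    Partrec fun q : Code × (ℕ × ℕ) × ℕ => premise q.1 q.2.1.1 q.2.1.2 q.2.2 := by
  have ha : Primrec fun q : Code × (ℕ × ℕ) × ℕ => q.2.1.1 :=
    Primrec.fst.comp (Primrec.fst.comp Primrec.snd)
  have hn : Primrec fun q : Code × (ℕ × ℕ) × ℕ => q.2.2 := Primrec.snd.comp Primrec.snd
  have hk : Primrec fun q : Code × (ℕ × ℕ) × ℕ => addRefl q.2.1.2 q.2.2 :=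
    primrec_addRefl.comp (Primrec.snd.comp (Primrec.fst.comp Primrec.snd)) hn
  have hax : Primrec fun q : Code × (ℕ × ℕ) × ℕ => tup [axC, addRefl q.2.1.2 q.2.2] :=
    primrec_tup.comp (Primrec.list_cons.comp (Primrec.const axC)
      (Primrec.list_cons.comp hk (Primrec.const [])))
  have hguard : Partrec fun r : (Code × (ℕ × ℕ) × ℕ) × ℕ =>
      if 3 * 5 ^ fiveLog r.1.2.1.1 = r.1.2.1.1 then
        (fundSeq r.1.2.1.1 (r.1.2.2 + 1)).bind (searchBelow r.2)
      else Part.some 0 := by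
    refine partrec_ite (p := fun r : (Code × (ℕ × ℕ) × ℕ) × ℕ =>
      3 * 5 ^ fiveLog r.1.2.1.1 = r.1.2.1.1)
      (primrecPred_isLim.comp (ha.comp Primrec.fst)) ?_ (Computable.const 0)
    exact (partrec_fundSeq.comp (ha.comp Primrec.fst).to_comp
      (Primrec.succ.comp (hn.comp Primrec.fst)).to_comp).bind
      (partrec_searchBelow.comp (Computable.snd.comp Computable.fst) Computable.snd)
  have hbody : Partrec₂ fun (q : Code × (ℕ × ℕ) × ℕ) (x : ℕ) =>
      (if 3 * 5 ^ fiveLog q.2.1.1 = q.2.1.1 then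
        (fundSeq q.2.1.1 (q.2.2 + 1)).bind (searchBelow x)
      else Part.some 0).map fun _ => reflProof q.1 x (addRefl q.2.1.2 q.2.2) := by
    refine hguard.map (Primrec.to_comp ?_)
    exact primrec_reflProof.comp (Primrec.pair (Primrec.fst.comp (Primrec.fst.comp Primrec.fst))
      (Primrec.pair (Primrec.snd.comp Primrec.fst) (hk.comp (Primrec.fst.comp Primrec.fst))))
  exact partrec_ite (p := fun q : Code × (ℕ × ℕ) × ℕ => q.2.1.1 = 1)
    (Primrec.eq.comp ha (Primrec.const 1)) hax.to_comp
    ((partrec_fundSeq.comp ha.to_comp hn.to_comp).bind hbody)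

/-- `c` computes the premises of its own codes `reflProof c a k`. -/
def ComputesPremises (c : Code) : Prop :=
  ∀ a k n, peval (Encodable.encode (c.curry (Nat.pair a k))) n = premise c a k n

theorem exists_computesPremises : ∃ c : Code, ComputesPremises c := by
  have hu : Primrec fun q : Code × ℕ => (q.1, q.2.unpair.1.unpair, q.2.unpair.2) :=
    Primrec.fst.pair ((Primrec.unpair.comp (Primrec.fst.comp (Primrec.unpair.comp
      Primrec.snd))).pair (Primrec.snd.comp (Primrec.unpair.comp Primrec.snd)))
  have h : Partrec₂ fun (c : Code) (m : ℕ) =>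
      premise c m.unpair.1.unpair.1 m.unpair.1.unpair.2 m.unpair.2 :=
    (partrec_premise.comp hu.to_comp).to₂
  obtain ⟨c, hc⟩ := Code.fixed_point₂ h
  refine ⟨c, fun a k n => ?_⟩
  rw [peval, Denumerable.ofNat_encode, Code.eval_curry, hc]
  simp

/-! ### Kleene's `O` -/

/-- The inductive characterization of Kleene's `O`. -/
inductive IsNotation : ℕ → Prop
  | one : IsNotation 1
  | step {a : ℕ} : IsNotation a → IsNotation (2 ^ a)
  | lim {e : ℕ} (h : ∀ n, (peval e n).Dom)
      (hm : ∀ n, KLt ((peval e n).get (h n)) ((peval e (n + 1)).get (h (n + 1))))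
      (hO : ∀ n, IsNotation ((peval e n).get (h n))) : IsNotation (3 * 5 ^ e)

theorem IsNotation.pos {a : ℕ} (h : IsNotation a) : 0 < a := by
  cases h <;> positivity

theorem KLt.isNotation {a b : ℕ} (h : KLt a b) : IsNotation a ∧ IsNotation b := by
  induction h with
  | base => exact ⟨.one, .step .one⟩
  | step _ ih => exact ⟨ih.2, .step ih.2⟩
  | lim h hm n ih => exact ⟨(ih n).1, .lim h hm fun n => (ih n).1⟩
  | trans _ _ ih₁ ih₂ => exact ⟨ih₁.1, ih₂.2⟩

theorem KO_iff_isNotation {a : ℕ} : KO a ↔ IsNotation a := by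
  refine ⟨fun h => (KLt.isNotation h).1, fun h => ?_⟩
  induction h with
  | one => exact .base
  | step _ ih => exact .step ih
  | lim h hm _ _ => exact .step (.lim h hm 0)

theorem IsNotation.exists_fundSeq {a : ℕ} (h : IsNotation a) (n : ℕ) :
    ∃ z ∈ fundSeq a n, z = 0 ∨ KLt z a := by
  cases h with
  | one => exact ⟨0, by simpa using (fundSeq_two_pow 0 n).symm ▸ Part.mem_some 0, Or.inl rfl⟩
  | @step b h => exact ⟨b, by rw [fundSeq_two_pow]; exact Part.mem_some b,
      Or.inr (KO_iff_isNotation.2 h)⟩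
  | @lim e h hm _ => exact ⟨_, by rw [fundSeq_three_mul]; exact Part.get_mem (h n),
      Or.inr (.lim h hm n)⟩

theorem IsNotation.exists_descend {a : ℕ} (h : IsNotation a) (l : List ℕ) (i : ℕ) :
    ∃ z ∈ descend a l (i + 1), z = 0 ∨ KLt z a := by
  induction i with
  | zero => simpa [descend_succ, descend_zero] using h.exists_fundSeq (l.getD 0 0)
  | succ i ih =>
    obtain ⟨z, hz, rfl | hza⟩ := ih
    · refine ⟨0, ?_, Or.inl rfl⟩
      rw [descend_succ]
      exact Part.mem_bind hz (by simp [fundSeq, twoLog])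
    · obtain ⟨w, hw, hwz⟩ := hza.isNotation.1.exists_fundSeq (l.getD (i + 1) 0)
      refine ⟨w, ?_, hwz.imp_right fun h => h.trans hza⟩
      rw [descend_succ]
      exact Part.mem_bind hz hw

theorem KLt.transGen_fundSeq {x y : ℕ} (h : KLt x y) :
    Relation.TransGen (fun y z => ∃ n, z ∈ fundSeq y n) y x := by
  induction h with
  | base => exact .single ⟨0, (fundSeq_two_pow 1 0).symm ▸ Part.mem_some 1⟩
  | @step a b _ _ => exact .single ⟨0, (fundSeq_two_pow b 0).symm ▸ Part.mem_some b⟩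
  | @lim e h _ n _ =>
    exact .single ⟨n, by rw [fundSeq_three_mul]; exact Part.get_mem (h n)⟩
  | trans _ _ ih₁ ih₂ => exact ih₂.trans ih₁

theorem exists_mem_descend {x y : ℕ}
    (h : Relation.TransGen (fun y z => ∃ n, z ∈ fundSeq y n) y x) :
    ∃ l : List ℕ, x ∈ descend y l (l.length.pred + 1) := by
  suffices ∃ n l, x ∈ descend y (n :: l) (l.length + 1) from
    let ⟨n, l, hl⟩ := this
    ⟨n :: l, hl⟩
  induction h using Relation.TransGen.head_induction_on with
  | single h =>
    obtain ⟨n, hn⟩ := h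
    exact ⟨n, [], by simpa [descend_cons, descend_zero] using hn⟩
  | head h _ ih =>
    obtain ⟨n, hn⟩ := h
    obtain ⟨m, l, hl⟩ := ih
    refine ⟨n, m :: l, ?_⟩
    rw [List.length_cons, descend_cons]
    exact Part.mem_bind hn hl

theorem searchBelow_dom_iff {x y : ℕ} (hx : IsNotation x) (hy : IsNotation y) :
    (searchBelow x y).Dom ↔ KLt x y := by
  constructor
  · intro h
    have hj := Nat.rfind_spec (Part.get_mem h)
    obtain ⟨z, hz, hzx⟩ := (Part.mem_map_iff _).1 hj
    obtain rfl := of_decide_eq_true hzx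
    obtain ⟨w, hw, hwy⟩ := hy.exists_descend _ _
    obtain rfl := Part.mem_unique hz hw
    exact hwy.resolve_left hx.pos.ne'
  · intro h
    obtain ⟨l, hl⟩ := exists_mem_descend h.transGen_fundSeq
    refine Nat.rfind_dom.2 ⟨Encodable.encode l, ?_, fun {j} _ => ?_⟩
    · rw [Part.mem_map_iff]
      refine ⟨x, ?_, by simp⟩
      rwa [Denumerable.ofNat_encode]
    · obtain ⟨z, hz, _⟩ := hy.exists_descend (Denumerable.ofNat (List ℕ) j)
        (Denumerable.ofNat (List ℕ) j).length.pred
      exact Part.dom_iff_mem.2 ⟨_, Part.mem_map _ hz⟩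

/-! ### Correctness of the reduction -/

theorem tup_injective : Function.Injective tup := fun _ _ h =>
  Encodable.encode_injective (Nat.succ_injective h)

theorem untup_tup (l : List ℕ) : untup (tup l) = l := by
  simp [untup, tup]

theorem decS_encS (Γ : Finset Sentence) : decS (encS Γ) = Γ := by
  simp [decS, encS]

theorem decF_encF (A : Sentence) : decF (encF A) = A := by
  simp [decF, encF]

theorem EndS_ax (Γ : Finset Sentence) : EndS (tup [axC, encS Γ]) = Γ := by
  simp [EndS, proj, untup_tup, decS_encS]

theorem EndS_reflProof (c : Code) (a : ℕ) {Γ : Finset Sentence} (hΓ : reflAll ∈ Γ) :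
    EndS (reflProof c a (encS Γ)) = Γ := by
  simp [EndS, reflProof, proj, untup_tup, decS_encS, decF_encF, omC, cutC, axC, omrepC, hΓ]

theorem isAxiom_union_reflInst (Γ : Finset Sentence) (n : ℕ) : IsAxiom (Γ ∪ {reflInst n}) :=
  ⟨reflInst n, by simp, rfl, rfl⟩

theorem premise_one (c : Code) (k n : ℕ) :
    premise c 1 k n = Part.some (tup [axC, addRefl k n]) := if_pos rfl

theorem premise_two_pow (c : Code) {b : ℕ} (hb : 0 < b) (k n : ℕ) :
    premise c (2 ^ b) k n = Part.some (reflProof c b (addRefl k n)) := by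
  simp [premise, fundSeq_two_pow, hb.ne', (two_pow_ne_three_mul b _).symm]

theorem premise_three_mul (c : Code) (e k n : ℕ) :
    premise c (3 * 5 ^ e) k n = (peval e n).bind fun x =>
      ((peval e (n + 1)).bind (searchBelow x)).map fun _ => reflProof c x (addRefl k n) := by
  have h : 3 * 5 ^ e ≠ 1 := (two_pow_ne_three_mul 0 e).symm
  simp only [premise, if_neg h, fiveLog_three_mul, if_true, fundSeq_three_mul]

theorem premise_three_mul_dom {c : Code} {e k n : ℕ} (h : (premise c (3 * 5 ^ e) k n).Dom) :
    ∃ (h₀ : (peval e n).Dom) (h₁ : (peval e (n + 1)).Dom),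
      (searchBelow ((peval e n).get h₀) ((peval e (n + 1)).get h₁)).Dom ∧
      (premise c (3 * 5 ^ e) k n).get h = reflProof c ((peval e n).get h₀) (addRefl k n) := by
  have hmem := Part.get_mem h
  generalize (premise c (3 * 5 ^ e) k n).get h = z at hmem
  rw [premise_three_mul] at hmem
  obtain ⟨x, hx, hz⟩ := Part.mem_bind_iff.1 hmem
  obtain ⟨j, hj, rfl⟩ := (Part.mem_map_iff _).1 hz
  obtain ⟨y, hy, hjy⟩ := Part.mem_bind_iff.1 hj
  obtain ⟨h₀, rfl⟩ := hx
  obtain ⟨h₁, rfl⟩ := hy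
  exact ⟨h₀, h₁, hjy.1, rfl⟩

theorem mem_premise_three_mul {c : Code} {e k n x y : ℕ} (hx : x ∈ peval e n)
    (hy : y ∈ peval e (n + 1)) (h : (searchBelow x y).Dom) :
    reflProof c x (addRefl k n) ∈ premise c (3 * 5 ^ e) k n := by
  rw [premise_three_mul]
  exact Part.mem_bind hx (Part.mem_map _ (Part.mem_bind hy (Part.get_mem h)))

theorem premise_eq_zero_step {c : Code} {a k n : ℕ} (h₁ : a ≠ 1) (h₂ : ∀ b, a ≠ 2 ^ b)
    (h₃ : ∀ e, a ≠ 3 * 5 ^ e) : premise c a k n = Part.some (reflProof c 0 (addRefl k n)) := by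
  simp [premise, fundSeq, h₁, (h₂ _).symm, (h₃ _).symm]

theorem isNotation_of_cGen {c : Code} (hc : ComputesPremises c) {C p r : Bool} {a k : ℕ}
    (h : CGen C p r (reflProof c a k)) :
    IsNotation a := by
  generalize hz : reflProof c a k = z at h
  induction h generalizing a k with
  | om Γ A hA hp htot hmem hend ih =>
    have hl := tup_injective hz
    simp only [List.cons.injEq] at hl
    obtain ⟨-, -, -, rfl, -⟩ := hl
    simp only [hc _ _ _] at htot ih
    by_cases h₁ : a = 1
    · exact h₁ ▸ .one
    by_cases h₂ : ∃ b, a = 2 ^ b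
    · obtain ⟨b, rfl⟩ := h₂
      have hb : 0 < b := Nat.pos_of_ne_zero fun hb => h₁ (by rw [hb, pow_zero])
      refine .step (ih 0 (k := addRefl k 0) ?_)
      simp only [premise_two_pow c hb, Part.get_some]
    by_cases h₃ : ∃ e, a = 3 * 5 ^ e
    · obtain ⟨e, rfl⟩ := h₃
      choose h₀ h₁ hs hget using fun n => premise_three_mul_dom (htot n)
      have hO : ∀ n, IsNotation ((peval e n).get (h₀ n)) := fun n => ih n (hget n).symm
      exact .lim h₀ (fun n => (searchBelow_dom_iff (hO n) (hO (n + 1))).1 (hs n)) hO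
    · push Not at h₂ h₃
      have h0 : IsNotation 0 := ih 0 (k := addRefl k 0) (by
        simp only [premise_eq_zero_step h₁ h₂ h₃, Part.get_some])
      exact absurd h0.pos (lt_irrefl 0)
  | _ =>
    have hl := tup_injective hz
    simp [omC, axC, andC, orC, exC, cutC, omrepC] at hl

theorem cGen_reflProof_of_premises {c : Code} (hc : ComputesPremises c) {C r : Bool} {a : ℕ}
    {Γ : Finset Sentence} (h : ∀ n, ∃ z ∈ premise c a (encS Γ) n, CGen C false r z ∧
      EndS z = Γ ∪ {reflInst n}) : CGen C false r (reflProof c a (encS Γ)) := by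
  simp only [← hc _ _ _] at h
  have hdom : ∀ n, (peval (Encodable.encode (c.curry (Nat.pair a (encS Γ)))) n).Dom := fun n =>
    Part.dom_iff_mem.2 ((h n).imp fun _ h => h.1)
  refine .om Γ _ _ (by simp) hdom (fun n => ?_) (fun n => ?_) <;>
  obtain ⟨z, hm, hC, hE⟩ := h n <;> rw [Part.get_eq_of_mem hm]
  · exact hC
  · exact hE

theorem IsNotation.cGen_reflProof {c : Code} (hc : ComputesPremises c) {C r : Bool} {a : ℕ}
    (h : IsNotation a) (Γ : Finset Sentence) (hΓ : reflAll ∈ Γ) :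
    CGen C false r (reflProof c a (encS Γ)) := by
  induction h generalizing Γ with
  | one =>
    refine cGen_reflProof_of_premises hc fun n => ⟨_, by rw [premise_one]; exact Part.mem_some _, ?_⟩
    rw [addRefl_encS]
    exact ⟨.ax _ (isAxiom_union_reflInst Γ n), EndS_ax _⟩
  | @step b hb ih =>
    refine cGen_reflProof_of_premises hc fun n =>
      ⟨_, by rw [premise_two_pow c hb.pos]; exact Part.mem_some _, ?_⟩
    rw [addRefl_encS]
    exact ⟨ih _ (Finset.mem_union_left _ hΓ), EndS_reflProof _ _ (Finset.mem_union_left _ hΓ)⟩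
  | @lim e h hm hO ih =>
    refine cGen_reflProof_of_premises hc fun n => ⟨_, mem_premise_three_mul
      (Part.get_mem (h n)) (Part.get_mem (h (n + 1)))
      ((searchBelow_dom_iff (hO n) (hO (n + 1))).2 (hm n)), ?_⟩
    rw [addRefl_encS]
    exact ⟨ih n _ (Finset.mem_union_left _ hΓ), EndS_reflProof _ _ (Finset.mem_union_left _ hΓ)⟩

/-! ### Ordinal lengths -/

theorem CGen.exists_cLen {C p : Bool} {a : ℕ} (h : CGen C p false a) : ∃ o, CLen a o := by
  induction h with
  | ax Γ _ => exact ⟨_, .ax _⟩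
  | and Γ A B _ _ _ _ iha ihb =>
    obtain ⟨⟨_, ha⟩, ⟨_, hb⟩⟩ := And.intro iha ihb
    exact ⟨_, .two _ _ _ _ _ _ _ (Or.inl rfl) ha hb⟩
  | or Γ A B _ _ ih => exact ⟨_, .one _ _ _ _ _ (Or.inl rfl) ih.choose_spec⟩
  | om Γ A hA _ htot _ _ ih =>
    choose o ho using ih
    exact ⟨_, .om _ _ _ htot o ho⟩
  | ex Γ A hA n _ _ ih => exact ⟨_, .one _ _ _ _ _ (Or.inr rfl) ih.choose_spec⟩
  | cut _ Γ A _ _ _ _ iha ihb =>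
    obtain ⟨⟨_, ha⟩, ⟨_, hb⟩⟩ := And.intro iha ihb
    exact ⟨_, .two _ _ _ _ _ _ _ (Or.inr rfl) ha hb⟩
  | omrep hr => cases hr

theorem IsNotation.exists_kOrd {a : ℕ} (h : IsNotation a) : ∃ o, KOrd a o := by
  induction h with
  | one => exact ⟨_, .one⟩
  | step _ ih => exact ⟨_, .step ih.choose_spec⟩
  | lim h _ _ ih =>
    choose o ho using ih
    exact ⟨_, .lim h o ho⟩

theorem KOrd.pos {a : ℕ} {o : Ordinal.{0}} (h : KOrd a o) : 0 < a := by
  cases h <;> positivity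

/-- The length of `reflProof c a k` exceeds the lengths of all its premises. -/
theorem CLen.exists_premise {c : Code} (hc : ComputesPremises c) {a k : ℕ} {o : Ordinal.{0}}
    (h : CLen (reflProof c a k) o) (n : ℕ) :
    ∃ (hd : (premise c a k n).Dom) (o' : Ordinal.{0}),
      CLen ((premise c a k n).get hd) o' ∧ o' + 1 ≤ o := by
  generalize hz : reflProof c a k = z at h
  cases h with
  | om g x e htot u hu =>
    have hl := tup_injective hz
    simp only [List.cons.injEq] at hl
    obtain ⟨-, -, -, rfl, -⟩ := hl
    simp only [hc _ _ _] at htot hu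
    exact ⟨htot n, u n, hu n, Ordinal.le_iSup (fun n => u n + 1) n⟩
  | one R g x a o hR h =>
    have hl := tup_injective hz
    rcases hR with rfl | rfl <;> simp [omC, orC, exC] at hl
  | ax => simpa [omC, axC] using tup_injective hz
  | two => simpa using tup_injective hz

theorem KOrd.le_cLen {c : Code} (hc : ComputesPremises c) {a : ℕ} {o : Ordinal.{0}}
    (h : KOrd a o) {k : ℕ} {o' : Ordinal.{0}} (h' : CLen (reflProof c a k) o') : o ≤ o' := by
  induction h generalizing k o' with
  | one => exact zero_le
  | @step a o h ih =>
    obtain ⟨hd, u, hu, hle⟩ := h'.exists_premise hc 0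
    simp only [premise_two_pow c h.pos, Part.get_some] at hu
    exact (add_le_add_left (ih hu) 1).trans hle
  | @lim e h o ho ih =>
    refine Ordinal.iSup_le fun n => ?_
    obtain ⟨hd, u, hu, hle⟩ := h'.exists_premise hc n
    obtain ⟨_, _, _, hget⟩ := premise_three_mul_dom hd
    rw [hget] at hu
    exact (ih n hu).trans ((le_add_of_nonneg_right (zero_le)).trans hle)

/-- A code of a proof of `∀x(x=x)` determined by `a`, of length exceeding `|a|`. -/
def reduction (c : Code) (a : ℕ) : ℕ :=
  if a = 0 then 0 else reflProof c (2 ^ a) (encS {reflAll})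

theorem primrec_reduction (c : Code) : Primrec (reduction c) :=
  Primrec.ite (Primrec.eq.comp Primrec.id (Primrec.const 0)) (Primrec.const 0)
    (primrec_reflProof.comp ((Primrec.const c).pair (primrec_two_pow.pair (Primrec.const _))))

theorem reduction_of_isNotation (c : Code) {a : ℕ} (h : IsNotation a) :
    reduction c a = reflProof c (2 ^ a) (encS {reflAll}) :=
  if_neg h.pos.ne'

theorem isNotation_of_step {a : ℕ} (ha : a ≠ 0) (h : IsNotation (2 ^ a)) : IsNotation a := by
  generalize hz : 2 ^ a = z at h
  cases h with
  | one => exact absurd hz (by simpa using ha)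
  | step h => exact Nat.pow_right_injective le_rfl hz ▸ h
  | lim => exact absurd hz (two_pow_ne_three_mul _ _)

theorem cGen_reduction_iff {c : Code} (hc : ComputesPremises c) {C r : Bool} {a : ℕ} :
    CGen C false r (reduction c a) ↔ KO a := by
  rw [KO_iff_isNotation]
  constructor
  · intro h
    by_cases ha : a = 0
    · rw [reduction, if_pos ha] at h
      generalize hz : 0 = z at h
      cases h <;> simp [tup] at hz
    · rw [reduction, if_neg ha] at h
      exact isNotation_of_step ha (isNotation_of_cGen hc h)
  · intro h
    rw [reduction_of_isNotation c h]
    exact h.step.cGen_reflProof hc _ (Finset.mem_singleton_self _)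

/-- **`Π¹₁`-hardness of `C_rec` and `C_rec^-`.**  There is a primitive
recursive `f` with `a ∈ O ↔ f(a) ∈ C_rec`; moreover for `a ∈ O`, `f(a)` is a
cut free code of a proof of `∀x(x=x)` of length `> |a|`, and also
`a ∈ O ↔ f(a) ∈ C_rec^-`.  So `f` reduces Kleene's `O` to both `C_rec` and
`C_rec^-`. -/
theorem crec_pi11_hard :
    ∃ f : ℕ → ℕ, Nat.Primrec f ∧
      (∀ a : ℕ, KO a ↔ Crec (f a)) ∧
      (∀ a : ℕ, KO a →
        CrecM (f a) ∧
        EndS (f a) = {sAll (.eq (.var 0) (.var 0)) (by decide)} ∧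
        (∃ o o' : Ordinal.{0}, KOrd a o ∧ CLen (f a) o' ∧ o < o') ∧
        (∀ o o' : Ordinal.{0}, KOrd a o → CLen (f a) o' → o < o')) ∧
      (∀ a : ℕ, KO a ↔ CrecM (f a)) := by
  obtain ⟨c, hc⟩ := exists_computesPremises
  have hlt : ∀ a, KO a → ∀ o o' : Ordinal.{0}, KOrd a o → CLen (reduction c a) o' → o < o' := by
    intro a ha o o' ho ho'
    rw [reduction_of_isNotation c (KO_iff_isNotation.1 ha)] at ho'
    exact Order.add_one_le_iff.1 (ho.step.le_cLen hc ho')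
  refine ⟨reduction c, Primrec.nat_iff.1 (primrec_reduction c),
    fun a => (cGen_reduction_iff hc).symm, fun a ha => ?_, fun a => (cGen_reduction_iff hc).symm⟩
  have hM : CrecM (reduction c a) := (cGen_reduction_iff hc).2 ha
  refine ⟨hM, ?_, ?_, hlt a ha⟩
  · rw [reduction_of_isNotation c (KO_iff_isNotation.1 ha)]
    exact EndS_reflProof c _ (Finset.mem_singleton_self _)
  · obtain ⟨o, ho⟩ := (KO_iff_isNotation.1 ha).exists_kOrd
    obtain ⟨o', ho'⟩ := hM.exists_cLen
    exact ⟨o, o', ho, ho', hlt a ha o o' ho ho'⟩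

end Shoen
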